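/- Let g ≥ 1 be a natural number and let τ be the linear automorphism of the exterior algebra Λ*(ℝ^g) (with basis b₁, …, b_g of ℝ^g) defined on the monomial basis by τ(b₁^{ε₁} ∧ ⋯ ∧ b_g^{ε_g}) := b₁^{1−ε₁} ∧ ⋯ ∧ b_g^{1−ε_g} for all (ε₁,…,ε_g) ∈ {0,1}^g (factors in increasing index order, with b_j^0 omitted). Let D be the linear automorphism of ℝ^g with D(b_j) = (−1)^j b_j. Then for every A ∈ SL(g,ℝ): τ ∘ Λ*(A) ∘ τ = Λ*(D ∘ (A⁻¹)ᵀ ∘ D), where Λ*(·) denotes the induced algebra automorphism of Λ*(ℝ^g) and (A⁻¹)ᵀ is the transpose of A⁻¹ with respect to the basis b₁, …, b_g. -/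

import Mathlib

noncomputable section

/-- The basis vector `b_j` (1-based `j = i+1`) inside the exterior algebra `Λ*(ℝ^g)`. -/
def b (g : ℕ) (i : Fin g) : ExteriorAlgebra ℝ (Fin g → ℝ) :=
  ExteriorAlgebra.ι ℝ (Pi.single i 1)

/-- The monomial `b_S = b_{i₁} ∧ ⋯ ∧ b_{iₖ}`, factors in increasing index order. -/
def mono (g : ℕ) (S : Finset (Fin g)) : ExteriorAlgebra ℝ (Fin g → ℝ) :=
  ((S.sort (· ≤ ·)).map fun i => b g i).prod

/-- The diagonal matrix `D` with `D(b_j) = (−1)^j b_j` (1-based exponent). -/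
def Dmat (g : ℕ) : Matrix (Fin g) (Fin g) ℝ :=
  Matrix.diagonal fun j => (-1 : ℝ) ^ ((j : ℕ) + 1)

open CliffordAlgebra in
/-- The exterior algebra map intertwines contractions. -/
theorem ExteriorAlgebra.map_contractLeft_comp {R M : Type*} [CommRing R] [AddCommGroup M]
    [Module R M] (f : M →ₗ[R] M) (d : Module.Dual R M) (x : ExteriorAlgebra R M) :
    ExteriorAlgebra.map f (contractLeft (Q := (0 : QuadraticForm R M)) (d ∘ₗ f) x) =
      contractLeft (Q := (0 : QuadraticForm R M)) d (ExteriorAlgebra.map f x) := by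
  induction x using CliffordAlgebra.left_induction with
  | algebraMap r =>
    rw [contractLeft_algebraMap, AlgHom.commutes, map_zero]
    exact (contractLeft_algebraMap (Q := 0) d r).symm
  | add x y hx hy => simp only [map_add, hx, hy]
  | ι_mul x m hx =>
    have h : ExteriorAlgebra.map f (CliffordAlgebra.ι 0 m) = CliffordAlgebra.ι 0 (f m) :=
      ExteriorAlgebra.map_apply_ι f m
    rw [contractLeft_ι_mul, map_sub, map_smul, map_mul, map_mul, hx, h, contractLeft_ι_mul]
    rfl

theorem AlternatingMap.eq_basis_det_smul {R M N ι : Type*} [CommRing R] [AddCommGroup M]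
    [Module R M] [AddCommGroup N] [Module R N] [Fintype ι] [DecidableEq ι]
    (e : Module.Basis ι R M) (f : M [⋀^ι]→ₗ[R] N) (v : ι → M) : f v = e.det v • f e := by
  suffices h : f = (LinearMap.toSpanSingleton R N (f e)).compAlternatingMap e.det by
    conv_lhs => rw [h]
    simp
  refine e.ext_alternating fun i hi => ?_
  let σ : Equiv.Perm ι := Equiv.ofBijective i (Finite.injective_iff_bijective.1 hi)
  change f (e ∘ σ) = (LinearMap.toSpanSingleton R N (f e)).compAlternatingMap e.det (e ∘ σ)
  simp [AlternatingMap.map_perm, Module.Basis.det_self]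

theorem b_mul_self (g : ℕ) (i : Fin g) : b g i * b g i = 0 :=
  ExteriorAlgebra.ι_sq_zero _

theorem b_mul_comm (g : ℕ) (i j : Fin g) : b g i * b g j = -(b g j * b g i) :=
  eq_neg_of_add_eq_zero_left (ExteriorAlgebra.ι_add_mul_swap _ _)

theorem b_mul_prod_orderedInsert (g : ℕ) (i : Fin g) (l : List (Fin g))
    (hl : l.Pairwise (· ≤ ·)) :
    b g i * (l.map (b g)).prod =
      (-1 : ℝ) ^ l.countP (· < i) • ((l.orderedInsert (· ≤ ·) i).map (b g)).prod := by
  induction l with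
  | nil => simp
  | cons a t ih =>
    rw [List.pairwise_cons] at hl
    by_cases h : i ≤ a
    · have h0 : (a :: t).countP (· < i) = 0 := by
        rw [List.countP_eq_zero]
        intro c hc
        rcases List.mem_cons.1 hc with rfl | hc
        · simpa using h
        · simpa using h.trans (hl.1 c hc)
      rw [h0, List.orderedInsert_cons_of_le _ _ h]
      simp
    · have ha : a < i := not_le.1 h
      rw [List.orderedInsert_of_not_le _ t h, List.countP_cons_of_pos (by simpa using ha), pow_succ,
        List.map_cons, List.prod_cons, List.map_cons, List.prod_cons, ← mul_assoc, b_mul_comm,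
        neg_mul, mul_assoc, ih hl.2]
      simp

theorem b_mul_mono_of_notMem (g : ℕ) (i : Fin g) (S : Finset (Fin g)) (hi : i ∉ S) :
    b g i * mono g S =
      (-1 : ℝ) ^ (S.filter (· < i)).card • mono g (insert i S) := by
  have h1 : (S.sort (· ≤ ·)).countP (· < i) = (S.filter (· < i)).card := by
    rw [← Multiset.coe_countP, Finset.sort_eq, Multiset.countP_eq_card_filter]
    simp [Finset.card_def]
  have h2 : (S.sort (· ≤ ·)).orderedInsert (· ≤ ·) i = (insert i S).sort (· ≤ ·) := by
    refine List.Perm.eq_of_pairwise' (r := (· ≤ ·))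
      ((Finset.pairwise_sort S (· ≤ ·)).orderedInsert i _) (Finset.pairwise_sort _ _) ?_
    refine (List.perm_orderedInsert _ i _).trans ?_
    rw [← Multiset.coe_eq_coe, ← Multiset.cons_coe, Finset.sort_eq, Finset.sort_eq,
      Finset.insert_val_of_notMem hi]
  rw [mono, mono, b_mul_prod_orderedInsert g i _ (Finset.pairwise_sort S (· ≤ ·)), h1, h2]

theorem mono_eq_smul_b_mul (g : ℕ) (i : Fin g) (S : Finset (Fin g)) (hi : i ∈ S) :
    mono g S = (-1 : ℝ) ^ (S.filter (· < i)).card • (b g i * mono g (S.erase i)) := by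
  have h : (S.erase i).filter (· < i) = S.filter (· < i) := by
    ext j
    simp only [Finset.mem_filter, Finset.mem_erase]
    exact ⟨fun h => ⟨h.1.2, h.2⟩, fun h => ⟨⟨h.2.ne, h.1⟩, h.2⟩⟩
  rw [b_mul_mono_of_notMem g i _ (Finset.notMem_erase i S), Finset.insert_erase hi, h, smul_smul,
    ← mul_pow]
  simp

theorem b_mul_mono_of_mem (g : ℕ) (i : Fin g) (S : Finset (Fin g)) (hi : i ∈ S) :
    b g i * mono g S = 0 := by
  rw [mono_eq_smul_b_mul g i S hi, mul_smul_comm, ← mul_assoc, b_mul_self, zero_mul, smul_zero]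

theorem mono_empty (g : ℕ) : mono g ∅ = 1 := by
  simp [mono]

/-- Contraction with a linear form on `ℝ^g`. -/
def contraction (g : ℕ) :
    Module.Dual ℝ (Fin g → ℝ) →ₗ[ℝ]
      ExteriorAlgebra ℝ (Fin g → ℝ) →ₗ[ℝ] ExteriorAlgebra ℝ (Fin g → ℝ) :=
  CliffordAlgebra.contractLeft (Q := (0 : QuadraticForm ℝ (Fin g → ℝ)))

theorem contraction_b_mul (g : ℕ) (d : Module.Dual ℝ (Fin g → ℝ)) (i : Fin g)
    (x : ExteriorAlgebra ℝ (Fin g → ℝ)) :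
    contraction g d (b g i * x) = d (Pi.single i 1) • x - b g i * contraction g d x :=
  CliffordAlgebra.contractLeft_ι_mul (Q := 0) d _ x

theorem contraction_proj_mono_of_notMem (g : ℕ) (i : Fin g) (S : Finset (Fin g)) (hi : i ∉ S) :
    contraction g (LinearMap.proj i) (mono g S) = 0 := by
  have key : ∀ l : List (Fin g), i ∉ l →
      contraction g (LinearMap.proj i) (l.map (b g)).prod = 0 := by
    intro l hl
    induction l with
    | nil => exact CliffordAlgebra.contractLeft_one (Q := 0) _
    | cons a t ih =>
      rw [List.mem_cons, not_or] at hl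
      rw [List.map_cons, List.prod_cons, contraction_b_mul, ih hl.2]
      simp [Pi.single_eq_of_ne hl.1]
  exact key _ (by simpa using hi)

theorem contraction_proj_mono_of_mem (g : ℕ) (i : Fin g) (S : Finset (Fin g)) (hi : i ∈ S) :
    contraction g (LinearMap.proj i) (mono g S) =
      (-1 : ℝ) ^ (S.filter (· < i)).card • mono g (S.erase i) := by
  rw [mono_eq_smul_b_mul g i S hi, map_smul, contraction_b_mul,
    contraction_proj_mono_of_notMem g i _ (Finset.notMem_erase i S)]
  simp

theorem ι_eq_sum_smul_b (g : ℕ) (v : Fin g → ℝ) :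
    ExteriorAlgebra.ι ℝ v = ∑ i, v i • b g i := by
  conv_lhs => rw [pi_eq_sum_univ' v]
  simp only [map_sum, map_smul, b]

theorem span_range_mono (g : ℕ) : Submodule.span ℝ (Set.range (mono g)) = ⊤ := by
  rw [eq_top_iff]
  rintro x -
  induction x using CliffordAlgebra.left_induction with
  | algebraMap r =>
    rw [Algebra.algebraMap_eq_smul_one]
    refine Submodule.smul_mem _ _ (Submodule.subset_span ⟨∅, mono_empty g⟩)
  | add x y hx hy => exact add_mem hx hy
  | ι_mul x m hx =>
    change ExteriorAlgebra.ι ℝ m * x ∈ _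
    rw [ι_eq_sum_smul_b, Finset.sum_mul]
    refine sum_mem fun i _ => ?_
    rw [smul_mul_assoc]
    refine Submodule.smul_mem _ _ ?_
    induction hx using Submodule.span_induction with
    | mem x hx =>
      obtain ⟨S, rfl⟩ := hx
      by_cases hi : i ∈ S
      · rw [b_mul_mono_of_mem g i S hi]
        exact zero_mem _
      · rw [b_mul_mono_of_notMem g i S hi]
        exact Submodule.smul_mem _ _ (Submodule.subset_span ⟨_, rfl⟩)
    | zero => simp
    | add x y _ _ hx hy => rw [mul_add]; exact add_mem hx hy
    | smul r x _ hx => rw [mul_smul_comm]; exact Submodule.smul_mem _ _ hx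

theorem map_mono_univ (g : ℕ) (f : (Fin g → ℝ) →ₗ[ℝ] (Fin g → ℝ)) :
    ExteriorAlgebra.map f (mono g Finset.univ) = LinearMap.det f • mono g Finset.univ := by
  have h : mono g Finset.univ = ExteriorAlgebra.ιMulti ℝ g (Pi.basisFun ℝ (Fin g)) := by
    rw [mono, Fin.sort_univ, ExteriorAlgebra.ιMulti_apply, List.ofFn_eq_map]
    simp [b]
  rw [h, ExteriorAlgebra.map_apply_ιMulti,
    AlternatingMap.eq_basis_det_smul (Pi.basisFun ℝ (Fin g)), Module.Basis.det_comp,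
    Module.Basis.det_self, mul_one]

theorem card_filter_lt_add_compl (g : ℕ) (i : Fin g) (S : Finset (Fin g)) :
    (S.filter (· < i)).card + (Sᶜ.filter (· < i)).card = i := by
  rw [← Finset.card_union_of_disjoint, ← Finset.filter_union, Finset.union_compl]
  · rw [Finset.filter_gt_eq_Iio, Fin.card_Iio]
  · exact Finset.disjoint_filter_filter disjoint_compl_right

/-- The linear form `w ↦ ∑ i, (-1)^i v i w i` (with `i` starting at `0`). -/
def signedDual (g : ℕ) (v : Fin g → ℝ) : Module.Dual ℝ (Fin g → ℝ) :=
  ∑ i, (v i * (-1) ^ (i : ℕ)) • LinearMap.proj i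

section complementation

variable {g : ℕ} {τ : ExteriorAlgebra ℝ (Fin g → ℝ) →ₗ[ℝ] ExteriorAlgebra ℝ (Fin g → ℝ)}

theorem complement_b_mul (hτ : ∀ S : Finset (Fin g), τ (mono g S) = mono g Sᶜ) (i : Fin g)
    (x : ExteriorAlgebra ℝ (Fin g → ℝ)) :
    τ (b g i * x) = (-1 : ℝ) ^ (i : ℕ) • contraction g (LinearMap.proj i) (τ x) := by
  suffices h : τ ∘ₗ LinearMap.mulLeft ℝ (b g i) =
      (-1 : ℝ) ^ (i : ℕ) • (contraction g (LinearMap.proj i) ∘ₗ τ) from LinearMap.congr_fun h x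
  refine LinearMap.ext_on_range (span_range_mono g) fun S => ?_
  simp only [LinearMap.comp_apply, LinearMap.mulLeft_apply, LinearMap.smul_apply, hτ]
  by_cases hi : i ∈ S
  · rw [b_mul_mono_of_mem g i S hi, map_zero, contraction_proj_mono_of_notMem g i _ (by simpa),
      smul_zero]
  · rw [b_mul_mono_of_notMem g i S hi, map_smul, hτ,
      contraction_proj_mono_of_mem g i _ (by simpa), Finset.compl_insert, smul_smul,
      ← card_filter_lt_add_compl g i S, pow_add, mul_assoc, ← mul_pow]
    simp

theorem complement_ι_mul (hτ : ∀ S : Finset (Fin g), τ (mono g S) = mono g Sᶜ)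
    (v : Fin g → ℝ) (x : ExteriorAlgebra ℝ (Fin g → ℝ)) :
    τ (ExteriorAlgebra.ι ℝ v * x) = contraction g (signedDual g v) (τ x) := by
  simp only [ι_eq_sum_smul_b, Finset.sum_mul, map_sum, signedDual, smul_mul_assoc, map_smul,
    complement_b_mul hτ, LinearMap.sum_apply, LinearMap.smul_apply, smul_smul]

theorem complement_complement (hτ : ∀ S : Finset (Fin g), τ (mono g S) = mono g Sᶜ)
    (x : ExteriorAlgebra ℝ (Fin g → ℝ)) : τ (τ x) = x := by
  suffices h : τ ∘ₗ τ = LinearMap.id from LinearMap.congr_fun h x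
  refine LinearMap.ext_on_range (span_range_mono g) fun S => ?_
  simp [hτ]

theorem complement_map (hτ : ∀ S : Finset (Fin g), τ (mono g S) = mono g Sᶜ)
    {f h : (Fin g → ℝ) →ₗ[ℝ] (Fin g → ℝ)} (hdet : LinearMap.det h = 1)
    (hfh : ∀ v, signedDual g (f v) ∘ₗ h = signedDual g v) (x : ExteriorAlgebra ℝ (Fin g → ℝ)) :
    τ (ExteriorAlgebra.map f x) = ExteriorAlgebra.map h (τ x) := by
  induction x using CliffordAlgebra.left_induction with
  | algebraMap r =>
    have h1 : τ 1 = mono g Finset.univ := by rw [← mono_empty, hτ, Finset.compl_empty]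
    rw [AlgHom.commutes, Algebra.algebraMap_eq_smul_one, map_smul, map_smul, h1, map_mono_univ, hdet, one_smul]
  | add x y hx hy => simp only [map_add, hx, hy]
  | ι_mul x v hx =>
    change τ (ExteriorAlgebra.map f (ExteriorAlgebra.ι ℝ v * x)) =
      ExteriorAlgebra.map h (τ (ExteriorAlgebra.ι ℝ v * x))
    rw [map_mul, ExteriorAlgebra.map_apply_ι, complement_ι_mul hτ, complement_ι_mul hτ, hx,
      ← hfh v]
    exact (ExteriorAlgebra.map_contractLeft_comp h (signedDual g (f v)) (τ x)).symm

end complementation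

theorem signedDual_apply (g : ℕ) (v w : Fin g → ℝ) :
    signedDual g v w = -(v ⬝ᵥ (Dmat g).mulVec w) := by
  simp only [signedDual, Dmat, LinearMap.sum_apply, LinearMap.smul_apply, LinearMap.proj_apply,
    smul_eq_mul, dotProduct, Matrix.mulVec_diagonal, ← Finset.sum_neg_distrib]
  exact Finset.sum_congr rfl fun i _ => by ring

theorem Dmat_mul_self (g : ℕ) : Dmat g * Dmat g = 1 := by
  rw [Dmat, Matrix.diagonal_mul_diagonal, ← Matrix.diagonal_one]
  simp [← mul_pow]

/-- let `τ` be the linear automorphism of `Λ*(ℝ^g)` defined on the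
monomial basis by `τ(b_S) = b_{Sᶜ}`.  Then for every `A ∈ SL(g,ℝ)`,
`τ ∘ Λ*(A) ∘ τ = Λ*(D ∘ (A⁻¹)ᵀ ∘ D)`. -/
theorem stmt18 (g : ℕ) (hg : 1 ≤ g)
    (τ : ExteriorAlgebra ℝ (Fin g → ℝ) →ₗ[ℝ] ExteriorAlgebra ℝ (Fin g → ℝ))
    (hτ : ∀ S : Finset (Fin g), τ (mono g S) = mono g Sᶜ)
    (A : Matrix.SpecialLinearGroup (Fin g) ℝ) :
    ∀ x : ExteriorAlgebra ℝ (Fin g → ℝ),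
      τ ((ExteriorAlgebra.map
            (Matrix.toLin' (A : Matrix (Fin g) (Fin g) ℝ))) (τ x))
        = (ExteriorAlgebra.map
            (Matrix.toLin'
              (Dmat g *
                Matrix.transpose
                  ((A⁻¹ : Matrix.SpecialLinearGroup (Fin g) ℝ) :
                    Matrix (Fin g) (Fin g) ℝ) * Dmat g))) x := by
  intro x
  have hdet : LinearMap.det (Matrix.toLin' (Dmat g * Matrix.transpose
      ((A⁻¹ : Matrix.SpecialLinearGroup (Fin g) ℝ) : Matrix (Fin g) (Fin g) ℝ) * Dmat g)) = 1 := by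
    rw [LinearMap.det_toLin', Matrix.det_mul, Matrix.det_mul, Matrix.det_transpose,
      Matrix.SpecialLinearGroup.det_coe, mul_one, ← Matrix.det_mul, Dmat_mul_self, Matrix.det_one]
  rw [complement_map hτ hdet, complement_complement hτ]
  intro v
  refine LinearMap.ext fun w => ?_
  have hA : (A : Matrix (Fin g) (Fin g) ℝ).transpose * Matrix.transpose
      ((A⁻¹ : Matrix.SpecialLinearGroup (Fin g) ℝ) : Matrix (Fin g) (Fin g) ℝ) = 1 := by
    rw [← Matrix.transpose_mul, ← Matrix.SpecialLinearGroup.coe_mul, inv_mul_cancel,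
      Matrix.SpecialLinearGroup.coe_one, Matrix.transpose_one]
  rw [LinearMap.comp_apply, signedDual_apply, signedDual_apply, Matrix.toLin'_apply,
    Matrix.toLin'_apply, Matrix.mulVec_mulVec, ← mul_assoc, ← mul_assoc, Dmat_mul_self, one_mul,
    ← Matrix.vecMul_transpose, ← Matrix.dotProduct_mulVec, Matrix.mulVec_mulVec, ← mul_assoc, hA,
    one_mul]
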